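/- (Functional form of Szemerédi's theorem) For every integer k ≥ 1 and every δ > 0 there exist a constant c(k,δ) > 0 and a threshold N₀(k,δ) such that for every N ≥ N₀ and every function f : [N] → [0,1] (extended by zero to all of ℤ) with E_{x ∈ [N]} f(x) ≥ δ, one has AP_k(f) = E_{x,d ∈ [N]} f(x)f(x+d)⋯f(x+kd) ≥ c(k,δ). -/

import Mathlib

namespace SZ

/-! ### Averages over finite types -/

section Avg

variable {X Y : Type}

/-- The average of a real function over a finite type. -/
noncomputable def avg [Finite X] (f : X → ℝ) : ℝ :=
  letI := Fintype.ofFinite X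
  (∑ x, f x) / (Fintype.card X : ℝ)

lemma avg_eq [Finite X] [i : Fintype X] (f : X → ℝ) :
    avg f = (∑ x, f x) / (Fintype.card X : ℝ) := by
  have : Fintype.ofFinite X = i := Subsingleton.elim _ _
  subst this
  rfl

lemma avg_const [Finite X] [Nonempty X] (c : ℝ) : avg (fun _ : X => c) = c := by
  let := Fintype.ofFinite X
  rw [avg_eq]
  simp

lemma avg_add [Finite X] (f g : X → ℝ) : avg (fun x => f x + g x) = avg f + avg g := by
  let := Fintype.ofFinite X
  simp only [avg_eq, Finset.sum_add_distrib, add_div]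

lemma avg_sub [Finite X] (f g : X → ℝ) : avg (fun x => f x - g x) = avg f - avg g := by
  let := Fintype.ofFinite X
  simp only [avg_eq, Finset.sum_sub_distrib, sub_div]

lemma avg_mul_left [Finite X] (c : ℝ) (f : X → ℝ) : avg (fun x => c * f x) = c * avg f := by
  let := Fintype.ofFinite X
  simp only [avg_eq, ← Finset.mul_sum, mul_div_assoc]

lemma avg_mono [Finite X] {f g : X → ℝ} (h : ∀ x, f x ≤ g x) : avg f ≤ avg g := by
  let := Fintype.ofFinite X
  simp only [avg_eq]
  gcongr
  exact h _

lemma avg_nonneg [Finite X] {f : X → ℝ} (h : ∀ x, 0 ≤ f x) : 0 ≤ avg f := by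
  let := Fintype.ofFinite X
  simp only [avg_eq]
  exact div_nonneg (Finset.sum_nonneg fun x _ => h x) (by positivity)

lemma avg_le_const [Finite X] [Nonempty X] {f : X → ℝ} {c : ℝ} (h : ∀ x, f x ≤ c) :
    avg f ≤ c := by
  simpa [avg_const] using avg_mono h

lemma const_le_avg [Finite X] [Nonempty X] {f : X → ℝ} {c : ℝ} (h : ∀ x, c ≤ f x) :
    c ≤ avg f := by
  simpa [avg_const] using avg_mono h

lemma avg_equiv [Finite X] [Finite Y] (e : X ≃ Y) (f : Y → ℝ) :
    avg (fun x => f (e x)) = avg f := by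
  let := Fintype.ofFinite X
  let := Fintype.ofFinite Y
  simp only [avg_eq, Fintype.card_congr e, Equiv.sum_comp e f]

lemma avg_prod [Finite X] [Finite Y] (f : X × Y → ℝ) :
    avg f = avg (fun x => avg (fun y => f (x, y))) := by
  let := Fintype.ofFinite X
  let := Fintype.ofFinite Y
  simp only [avg_eq, Fintype.sum_prod_type, Fintype.card_prod, Nat.cast_mul, ← Finset.sum_div,
    div_div, mul_comm]

lemma avg_comm [Finite X] [Finite Y] (f : X → Y → ℝ) :
    avg (fun x => avg (fun y => f x y)) = avg (fun y => avg (fun x => f x y)) := by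
  rw [← avg_prod (fun p : X × Y => f p.1 p.2), ← avg_prod (fun p : Y × X => f p.2 p.1),
    ← avg_equiv (Equiv.prodComm X Y)]
  rfl

lemma avg_sum {T : Type} [Finite X] [Fintype T] (f : T → X → ℝ) :
    avg (fun x => ∑ t, f t x) = ∑ t, avg (f t) := by
  let := Fintype.ofFinite X
  simp only [avg_eq, ← Finset.sum_div]
  rw [Finset.sum_comm]

lemma exists_avg_le [Finite X] [Nonempty X] (f : X → ℝ) : ∃ x, avg f ≤ f x := by
  by_contra! h
  let := Fintype.ofFinite X
  have h1 : ∑ x : X, f x < ∑ x : X, avg f :=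
    Finset.sum_lt_sum_of_nonempty Finset.univ_nonempty fun x _ => h x
  have h2 : (0 : ℝ) < Fintype.card X := by exact_mod_cast Fintype.card_pos
  rw [avg_eq] at h1
  simp only [Finset.sum_const, Finset.card_univ, nsmul_eq_mul] at h1
  rw [mul_div_cancel₀ _ h2.ne'] at h1
  exact lt_irrefl _ h1

lemma avg_sumElim {ι κ γ : Type} [Finite ι] [Finite κ] [Finite γ] (f : (ι ⊕ κ → γ) → ℝ) :
    avg f = avg (fun w : ι → γ => avg (fun z : κ → γ => f (Sum.elim w z))) := by
  rw [← avg_prod (fun p : (ι → γ) × (κ → γ) => f (Sum.elim p.1 p.2))]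
  exact (avg_equiv (Equiv.sumArrowEquivProdArrow ι κ γ).symm f).symm

open Classical in
/-- The real-valued indicator of a proposition. -/
noncomputable def ind (p : Prop) : ℝ := if p then 1 else 0

lemma ind_nonneg (p : Prop) : 0 ≤ ind p := by unfold ind; split_ifs <;> norm_num
lemma ind_le_one (p : Prop) : ind p ≤ 1 := by unfold ind; split_ifs <;> norm_num
lemma ind_true {p : Prop} (h : p) : ind p = 1 := by simp [ind, h]
lemma ind_false {p : Prop} (h : ¬ p) : ind p = 0 := by simp [ind, h]
lemma ind_mono {p q : Prop} (h : p → q) : ind p ≤ ind q := by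
  by_cases hp : p
  · rw [ind_true hp, ind_true (h hp)]
  · rw [ind_false hp]; exact ind_nonneg q

/-- The density of a subset of a finite type. -/
noncomputable def dens [Finite X] (A : Set X) : ℝ := avg (fun x => ind (x ∈ A))

lemma dens_nonneg [Finite X] (A : Set X) : 0 ≤ dens A := avg_nonneg fun _ => ind_nonneg _

lemma dens_le_one [Finite X] [Nonempty X] (A : Set X) : dens A ≤ 1 :=
  avg_le_const fun _ => ind_le_one _

lemma nonempty_of_dens_pos [Finite X] {A : Set X} (h : 0 < dens A) : A.Nonempty := by
  by_contra hA
  rw [Set.not_nonempty_iff_eq_empty] at hA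
  subst hA
  let := Fintype.ofFinite X
  have : dens (∅ : Set X) = 0 := by
    unfold dens
    rw [avg_eq]
    simp [ind]
  linarith

end Avg

/-! ### Combinatorial subspaces -/

section Subspaces

variable {γ ι η ζ κ : Type}

/-- Evaluation of a parametrised word. -/
def ev (V : ι → γ ⊕ η) (y : η → γ) : ι → γ := fun i => Sum.elim id y (V i)

/-- Every variable occurs. -/
def Proper (V : ι → γ ⊕ η) : Prop := ∀ e, ∃ i, V i = Sum.inr e

/-- Composition of parametrised words. -/
def comp (V : ι → γ ⊕ η) (W : η → γ ⊕ ζ) : ι → γ ⊕ ζ := fun i => Sum.elim Sum.inl W (V i)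

lemma ev_comp (V : ι → γ ⊕ η) (W : η → γ ⊕ ζ) (y : ζ → γ) :
    ev (comp V W) y = ev V (ev W y) := by
  funext i
  unfold ev comp
  cases V i <;> rfl

lemma Proper.comp {V : ι → γ ⊕ η} {W : η → γ ⊕ ζ} (hV : Proper V) (hW : Proper W) :
    Proper (comp V W) := by
  intro e
  obtain ⟨j, hj⟩ := hW e
  obtain ⟨i, hi⟩ := hV j
  exact ⟨i, by simp [SZ.comp, hi, hj]⟩

lemma ev_injective {V : ι → γ ⊕ η} (hV : Proper V) : Function.Injective (ev V) := by
  intro x y h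
  funext e
  obtain ⟨i, hi⟩ := hV e
  have := congrFun h i
  simpa [ev, hi] using this

/-- `A` contains no subspace with variables indexed by `η`. -/
def NoSub (η : Type) (A : Set (ι → γ)) : Prop :=
  ∀ V : ι → γ ⊕ η, Proper V → ∃ y, ev V y ∉ A

lemma NoSub.pull {V : ι → γ ⊕ ζ} (hV : Proper V) {A : Set (ι → γ)} (hA : NoSub η A) :
    NoSub η {y | ev V y ∈ A} := by
  intro W hW
  obtain ⟨y, hy⟩ := hA (SZ.comp V W) (hV.comp hW)
  exact ⟨y, by simpa [ev_comp] using hy⟩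

/-- Fix the left block. -/
def fixL (w : ι → γ) : ι ⊕ κ → γ ⊕ κ := Sum.elim (fun i => Sum.inl (w i)) Sum.inr

lemma fixL_proper (w : ι → γ) : Proper (fixL w : ι ⊕ κ → γ ⊕ κ) := fun e => ⟨Sum.inr e, rfl⟩

lemma ev_fixL (w : ι → γ) (z : κ → γ) : ev (fixL w) z = Sum.elim w z := by
  funext i
  cases i <;> rfl

/-- Fix the right block. -/
def fixR (z : κ → γ) : ι ⊕ κ → γ ⊕ ι := Sum.elim Sum.inr (fun i => Sum.inl (z i))

lemma fixR_proper (z : κ → γ) : Proper (fixR z : ι ⊕ κ → γ ⊕ ι) := fun e => ⟨Sum.inl e, rfl⟩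

lemma ev_fixR (w : ι → γ) (z : κ → γ) : ev (fixR z) w = Sum.elim w z := by
  funext i
  cases i <;> rfl

/-- The density Hales-Jewett property for the alphabet `γ`. -/
def DHJ (γ : Type) [Finite γ] : Prop :=
  ∀ ε : ℝ, 0 < ε → ∃ (ι : Type) (_ : Finite ι), ∀ A : Set (ι → γ), ε ≤ dens A → ¬ NoSub Unit A

end Subspaces

/-! ### Extremal density -/

section Extremal

variable {γ : Type} [Finite γ] [Nonempty γ]

lemma extremal (P : ∀ ι : Type, Set (ι → γ) → Prop)
    (hP : ∀ (ι η : Type) (A : Set (ι → γ)) (V : ι → γ ⊕ η), Proper V → P ι A →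
      P η {y | ev V y ∈ A})
    {ε : ℝ} (hbig : ∀ (ι : Type) [Finite ι], ∃ A, P ι A ∧ ε ≤ dens A) :
    ∃ δ : ℝ, ε ≤ δ ∧
      (∀ η : ℝ, 0 < η → ∃ (κ : Type) (_ : Finite κ), ∀ A, P κ A → dens A ≤ δ + η) ∧
      (∀ (ι κ₁ : Type) [Finite ι] [Finite κ₁] (η : ℝ), 0 < η →
        ∃ (κ₀ : Type) (_ : Finite κ₀) (A : Set (ι ⊕ (κ₁ ⊕ κ₀) → γ)), P _ A ∧
          ∀ w : ι → γ, δ - η ≤ dens {z : κ₁ ⊕ κ₀ → γ | Sum.elim w z ∈ A}) := by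
  set S : Set ℝ := {r | ∃ (κ : Type) (_ : Finite κ), ∀ A, P κ A → dens A ≤ r} with hS
  have hne : S.Nonempty := ⟨1, Unit, inferInstance, fun A _ => dens_le_one A⟩
  have hlow : ∀ r ∈ S, ε ≤ r := by
    rintro r ⟨κ, hκ, h⟩
    obtain ⟨A, hA, hA'⟩ := hbig κ
    exact hA'.trans (h A hA)
  have hbdd : BddBelow S := ⟨ε, hlow⟩
  have hup : ∀ η : ℝ, 0 < η → ∃ (κ : Type) (_ : Finite κ), ∀ A, P κ A → dens A ≤ sInf S + η := by
    intro η hη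
    obtain ⟨r, ⟨κ, hκ, h⟩, hr⟩ := exists_lt_of_csInf_lt hne (lt_add_of_pos_right (sInf S) hη)
    exact ⟨κ, hκ, fun A hA => (h A hA).trans hr.le⟩
  refine ⟨sInf S, le_csInf hne hlow, hup, ?_⟩
  classical
  intro ι κ₁ _ _ η hη
  let := Fintype.ofFinite (ι → γ)
  set C : ℝ := (Fintype.card (ι → γ) : ℝ) with hC
  have hCpos : 0 < C := by rw [hC]; exact_mod_cast Fintype.card_pos
  have hη' : 0 < η / (2 * C) := by positivity
  obtain ⟨κ₀, hκ₀, h0⟩ := hup _ hη'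
  obtain ⟨A, hA, hAd⟩ : ∃ A, P (ι ⊕ (κ₁ ⊕ κ₀)) A ∧ sInf S - η / (2 * C) < dens A := by
    by_contra! hcon
    have : sInf S ≤ sInf S - η / (2 * C) := csInf_le hbdd ⟨_, inferInstance, hcon⟩
    linarith
  refine ⟨κ₀, hκ₀, A, hA, ?_⟩
  have hsec : ∀ w : ι → γ, dens {z : κ₁ ⊕ κ₀ → γ | Sum.elim w z ∈ A} ≤ sInf S + η / (2 * C) := by
    intro w
    unfold dens
    rw [avg_sumElim]
    refine avg_le_const fun u => ?_
    have h1 : P _ {z : κ₁ ⊕ κ₀ → γ | ev (fixL w) z ∈ A} := hP _ _ _ _ (fixL_proper w) hA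
    have h2 := h0 _ (hP _ _ _ _ (fixL_proper u) h1)
    unfold dens at h2
    simpa [ev_fixL] using h2
  intro w
  have hsum : dens A = (∑ w : ι → γ, dens {z : κ₁ ⊕ κ₀ → γ | Sum.elim w z ∈ A}) / C := by
    rw [dens, avg_sumElim, avg_eq]
    rfl
  rw [hsum, lt_div_iff₀ hCpos] at hAd
  have hle : ∑ v ∈ Finset.univ.erase w, dens {z : κ₁ ⊕ κ₀ → γ | Sum.elim v z ∈ A} ≤
      (C - 1) * (sInf S + η / (2 * C)) := by
    refine (Finset.sum_le_card_nsmul _ _ _ fun v _ => hsec v).trans (le_of_eq ?_)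
    rw [Finset.card_erase_of_mem (Finset.mem_univ w), Finset.card_univ, nsmul_eq_mul,
      Nat.cast_sub Fintype.card_pos, Nat.cast_one]
  rw [← Finset.add_sum_erase _ _ (Finset.mem_univ w)] at hAd
  have hCη : C * (η / (2 * C)) = η / 2 := by field_simp
  nlinarith

end Extremal

/-! ### Consequences of the density Hales-Jewett property for `α` -/

section Insensitive

variable {α : Type} {ι η : Type}

lemma probDHJ [Finite α] [Nonempty α] (h : DHJ α) {δ : ℝ} (hδ : 0 < δ) :
    ∃ (ι : Type) (_ : Finite ι) (θ : ℝ), 0 < θ ∧ ∀ (Ω : Type) [Finite Ω] [Nonempty Ω]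
      (S : Ω → Set (ι → α)), (∀ w, δ ≤ avg fun z => ind (w ∈ S z)) →
      ∃ t : ι → α ⊕ Unit, Proper t ∧ θ ≤ avg fun z => ind (∀ i : Unit → α, ev t i ∈ S z) := by
  obtain ⟨ι, hι, hA⟩ := h (δ / 2) (by positivity)
  let := Fintype.ofFinite (ι → α ⊕ Unit)
  have hL : (0 : ℝ) < Fintype.card (ι → α ⊕ Unit) := by exact_mod_cast Fintype.card_pos
  refine ⟨ι, hι, (δ / 2) / Fintype.card (ι → α ⊕ Unit), by positivity, ?_⟩
  intro Ω _ _ S hS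
  by_contra! hcon
  have h1 : δ ≤ avg fun z => dens (S z) := by
    unfold dens
    rw [avg_comm]
    exact const_le_avg hS
  have h2 : ∀ z, dens (S z) ≤ δ / 2 +
      ∑ t : ι → α ⊕ Unit, ind (Proper t ∧ ∀ i : Unit → α, ev t i ∈ S z) := by
    intro z
    have hnn : ∀ t : ι → α ⊕ Unit, 0 ≤ ind (Proper t ∧ ∀ i : Unit → α, ev t i ∈ S z) :=
      fun t => ind_nonneg _
    rcases le_total (dens (S z)) (δ / 2) with hz | hz
    · have := Finset.sum_nonneg fun t (_ : t ∈ Finset.univ) => hnn t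
      linarith
    · have := hA _ hz
      unfold NoSub at this
      push Not at this
      obtain ⟨t, ht, ht'⟩ := this
      have h3 := Finset.single_le_sum (fun t _ => hnn t) (Finset.mem_univ t)
      rw [ind_true ⟨ht, ht'⟩] at h3
      have := dens_le_one (S z)
      linarith
  have h3 := avg_mono h2
  rw [avg_add, avg_const, avg_sum] at h3
  have h4 : ∑ t : ι → α ⊕ Unit, avg (fun z => ind (Proper t ∧ ∀ i : Unit → α, ev t i ∈ S z)) <
      ∑ t : ι → α ⊕ Unit, (δ / 2) / Fintype.card (ι → α ⊕ Unit) := by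
    refine Finset.sum_lt_sum_of_nonempty Finset.univ_nonempty fun t _ => ?_
    by_cases ht : Proper t
    · simpa [ht] using hcon t ht
    · simp only [ht, false_and, ind_false not_false, avg_const]
      positivity
  simp only [Finset.sum_const, Finset.card_univ, nsmul_eq_mul] at h4
  rw [mul_div_cancel₀ _ hL.ne'] at h4
  linarith

/-- Replace the extra letter by `a`. -/
def mg (a : α) (x : ι → α ⊕ Unit) : ι → α ⊕ Unit :=
  fun j => Sum.elim Sum.inl (fun _ => Sum.inl a) (x j)

/-- `E` does not distinguish the letter `a` from the extra letter. -/
def Insens (a : α) (E : Set (ι → α ⊕ Unit)) : Prop := ∀ x, mg a x ∈ E ↔ x ∈ E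

lemma Insens.of_eq {a : α} {E : Set (ι → α ⊕ Unit)} (h : Insens a E) {x y : ι → α ⊕ Unit}
    (hxy : mg a x = mg a y) : x ∈ E ↔ y ∈ E := by
  rw [← h x, ← h y, hxy]

lemma Insens.compl {a : α} {E : Set (ι → α ⊕ Unit)} (h : Insens a E) : Insens a Eᶜ :=
  fun x => not_congr (h x)

lemma Insens.pull {a : α} {E : Set (ι → α ⊕ Unit)} (h : Insens a E)
    (V : ι → (α ⊕ Unit) ⊕ η) : Insens a {y | ev V y ∈ E} := by
  intro y
  refine h.of_eq ?_
  funext j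
  simp only [mg, ev]
  rcases V j with b | e
  · rfl
  · simp only [Sum.elim_inr, mg]
    rcases y e <;> rfl

lemma insens_sub [Finite α] [Nonempty α] (h : DHJ α) (a : α) (η : Type) [Finite η] : ∀ ε : ℝ, 0 < ε →
    ∃ (ι : Type) (_ : Finite ι), ∀ E : Set (ι → α ⊕ Unit), Insens a E → ε ≤ dens E →
      ¬ NoSub η E := by
  refine Finite.induction_empty_option (P := fun η : Type => ∀ ε : ℝ, 0 < ε →
    ∃ (ι : Type) (_ : Finite ι), ∀ E : Set (ι → α ⊕ Unit), Insens a E → ε ≤ dens E →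
      ¬ NoSub η E) ?_ ?_ ?_ η
  · intro η η' e ih ε hε
    obtain ⟨ι, hι, hE⟩ := ih ε hε
    refine ⟨ι, hι, fun E hE1 hE2 hno => hE E hE1 hE2 ?_⟩
    intro V hV
    obtain ⟨y, hy⟩ := hno (fun i => Sum.map id e (V i)) (by
      intro f
      obtain ⟨i, hi⟩ := hV (e.symm f)
      exact ⟨i, by simp [hi]⟩)
    refine ⟨fun j => y (e j), ?_⟩
    have heq : ev V (fun j => y (e j)) = ev (fun i => Sum.map id e (V i)) y := by
      funext i
      simp only [ev]
      rcases V i <;> rfl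
    rwa [heq]
  · intro ε hε
    refine ⟨Unit, inferInstance, fun E _ hE2 hno => ?_⟩
    obtain ⟨x, hx⟩ := nonempty_of_dens_pos (hε.trans_le hE2)
    obtain ⟨y, hy⟩ := hno (fun i => Sum.inl (x i)) (fun e => e.elim)
    exact hy hx
  · intro η _ ih ε hε
    by_contra! hcon
    obtain ⟨δ, hδ, -, hfib⟩ := extremal (γ := α ⊕ Unit)
      (fun ι E => Insens a E ∧ NoSub (Option η) E)
      (fun ι ζ A V hV hA => ⟨hA.1.pull V, hA.2.pull hV⟩) (ε := ε)
      (fun ι hι => by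
        obtain ⟨E, h1, h2, h3⟩ := hcon ι hι
        exact ⟨E, ⟨h1, h3⟩, h2⟩)
    have hδ0 : 0 < δ := hε.trans_le hδ
    obtain ⟨ι, hι, θ, hθ, hprob⟩ := probDHJ h (half_pos hδ0)
    obtain ⟨κ₁, hκ₁, hsub⟩ := ih θ hθ
    obtain ⟨κ₀, hκ₀, A, ⟨hAi, hAn⟩, hA⟩ := hfib ι κ₁ (δ / 2) (half_pos hδ0)
    obtain ⟨t, ht, htθ⟩ := hprob (κ₁ ⊕ κ₀ → α ⊕ Unit)
      (fun z => {w | Sum.elim (fun j => Sum.inl (w j)) z ∈ A}) (fun w => by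
        have := hA (fun j => Sum.inl (w j))
        rw [sub_half] at this
        exact this)
    rw [avg_sumElim, avg_comm] at htθ
    obtain ⟨u, hu⟩ := exists_avg_le (fun u : κ₀ → α ⊕ Unit => avg fun v : κ₁ → α ⊕ Unit =>
      ind (∀ i : Unit → α, ev t i ∈ {w : ι → α | Sum.elim (fun j => (Sum.inl (w j) : α ⊕ Unit))
        (Sum.elim v u) ∈ A}))
    have hu2 := htθ.trans hu
    have hins : Insens a {v : κ₁ → α ⊕ Unit | ∀ i : Unit → α, ev t i ∈
        {w : ι → α | Sum.elim (fun j => (Sum.inl (w j) : α ⊕ Unit)) (Sum.elim v u) ∈ A}} := by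
      intro v
      refine forall_congr' fun i => ?_
      refine hAi.of_eq ?_
      funext j
      rcases j with j | j | j
      · rfl
      · simp only [mg, Sum.elim_inr, Sum.elim_inl]
        rcases v j <;> rfl
      · rfl
    have hW := hsub _ hins hu2
    unfold NoSub at hW
    push Not at hW
    obtain ⟨W, hW, hWA⟩ := hW
    obtain ⟨y, hy⟩ := hAn (Sum.elim (fun j => Sum.map Sum.inl (fun _ => none) (t j))
      (Sum.elim (fun j => Sum.map id some (W j)) (fun j => Sum.inl (u j)))) (by
        rintro (_ | e)
        · obtain ⟨i, hi⟩ := ht ()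
          exact ⟨Sum.inl i, by simp [hi]⟩
        · obtain ⟨i, hi⟩ := hW e
          exact ⟨Sum.inr (Sum.inl i), by simp [hi]⟩)
    apply hy
    have key := hWA (fun e => y (some e)) (fun _ => Sum.elim id (fun _ => a) (y none))
    refine (hAi.of_eq ?_).1 key
    funext j
    rcases j with j | j | j
    · simp only [mg, ev, Sum.elim_inl]
      rcases t j with b | b
      · rfl
      · simp only [Sum.elim_inr, Sum.map_inr]
        rcases y none <;> rfl
    · simp only [mg, ev, Sum.elim_inl, Sum.elim_inr]
      rcases W j <;> rfl
    · rfl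

end Insensitive

/-! ### Functions with non-positive averages on subspaces -/

section Structured

variable {α : Type} {ι η ζ κ : Type}

/-- Sets generated by insensitive sets, one for each letter in the list. -/
def Cls : List α → Set (ι → α ⊕ Unit) → Prop
  | [], F => F = Set.univ ∨ F = ∅
  | a :: l, F => ∃ E F₁ F₀ : Set (ι → α ⊕ Unit), Insens a E ∧ Cls l F₁ ∧ Cls l F₀ ∧
      ∀ x, x ∈ F ↔ (x ∈ E ∧ x ∈ F₁) ∨ (x ∈ Eᶜ ∧ x ∈ F₀)

lemma Cls.pull (V : ι → (α ⊕ Unit) ⊕ η) : ∀ (l : List α) (F : Set (ι → α ⊕ Unit)), Cls l F →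
    Cls l {y | ev V y ∈ F}
  | [], F, h => by
    rcases h with rfl | rfl
    · exact Or.inl rfl
    · exact Or.inr rfl
  | a :: l, F, ⟨E, F₁, F₀, hE, h1, h0, hF⟩ =>
    ⟨_, _, _, hE.pull V, Cls.pull V l F₁ h1, Cls.pull V l F₀ h0, fun y => hF (ev V y)⟩

lemma Cls.univ : ∀ l : List α, Cls l (Set.univ : Set (ι → α ⊕ Unit))
  | [] => Or.inl rfl
  | a :: l => ⟨Set.univ, Set.univ, Set.univ, fun _ => Iff.rfl, Cls.univ l, Cls.univ l,
      fun x => by simp⟩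

lemma Cls.not_all (D : α → Set (ι → α ⊕ Unit)) (hD : ∀ a, Insens a (D a)) :
    ∀ l : List α, Cls l {x | ∃ a ∈ l, x ∉ D a}
  | [] => Or.inr (by simp)
  | a :: l => ⟨D a, _, Set.univ, hD a, Cls.not_all D hD l, Cls.univ l, fun x => by
      simp only [List.mem_cons, exists_eq_or_imp, Set.mem_ofPred_eq, Set.mem_compl_iff,
        Set.mem_univ, and_true]
      by_cases hx : x ∈ D a <;> simp [hx]⟩

/-- `h` is bounded by one and has non-positive average on all `η`-dimensional subspaces. -/
def Neg (η : Type) [Finite η] {γ : Type} [Finite γ] (h : (ι → γ) → ℝ) : Prop :=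
  (∀ x, h x ≤ 1) ∧ ∀ V : ι → γ ⊕ η, Proper V → avg (fun y => h (ev V y)) ≤ 0

lemma Neg.pull {γ : Type} [Finite γ] [Finite η] {h : (ι → γ) → ℝ} (hh : Neg η h)
    {V : ι → γ ⊕ ζ} (hV : Proper V) : Neg η (fun y => h (ev V y)) :=
  ⟨fun y => hh.1 _, fun W hW => by
    have := hh.2 (SZ.comp V W) (hV.comp hW)
    simpa only [ev_comp] using this⟩

lemma avg_range {X Y : Type} [Finite X] [Finite Y] [Nonempty Y] {g : Y → X}
    (hg : Function.Injective g) (f : X → ℝ) :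
    avg (fun x => f x * ind (x ∈ Set.range g)) =
      (Nat.card Y / Nat.card X : ℝ) * avg (fun y => f (g y)) := by
  classical
  let := Fintype.ofFinite X
  let := Fintype.ofFinite Y
  rw [avg_eq, avg_eq, Nat.card_eq_fintype_card, Nat.card_eq_fintype_card]
  have h1 : ∑ x, f x * ind (x ∈ Set.range g) = ∑ y, f (g y) := by
    rw [← Finset.sum_image (s := Finset.univ) (g := g) (f := f) (fun a _ b _ h => hg h)]
    symm
    refine Finset.sum_subset_zero_on_sdiff (Finset.subset_univ _) ?_ ?_
    · intro x hx
      rw [ind_false, mul_zero]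
      simpa using hx
    · intro x hx
      rw [ind_true, mul_one]
      simpa using hx
  have hY : (Fintype.card Y : ℝ) ≠ 0 := by exact_mod_cast Fintype.card_ne_zero
  rw [h1]
  field_simp

variable [Finite α]

/-- Structured sets do not correlate with functions having non-positive averages on subspaces. -/
def TT (l : List α) : Prop :=
  ∀ (η : Type) [Finite η] (ε : ℝ), 0 < ε → ∃ (ι : Type) (_ : Finite ι),
    ∀ h : (ι → α ⊕ Unit) → ℝ, Neg η h → ∀ F : Set (ι → α ⊕ Unit), Cls l F →
      avg (fun x => h x * ind (x ∈ F)) ≤ ε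

lemma TT_nil : TT ([] : List α) := by
  intro η _ ε hε
  refine ⟨η, inferInstance, fun h hh F hF => ?_⟩
  rcases hF with rfl | rfl
  · have := hh.2 Sum.inr (fun e => ⟨e, rfl⟩)
    have h2 : avg h ≤ 0 := this
    simp only [ind_true (Set.mem_univ _), mul_one]
    exact h2.trans hε.le
  · simp only [ind_false (Set.notMem_empty _), mul_zero, avg_const]
    exact hε.le

lemma TT_inter [Nonempty α] (hα : DHJ α) (a : α) (l : List α) (hl : TT l) (η : Type) [Finite η]
    (ε : ℝ) (hε : 0 < ε) : ∃ (ι : Type) (_ : Finite ι),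
    ∀ h : (ι → α ⊕ Unit) → ℝ, Neg η h → ∀ E F : Set (ι → α ⊕ Unit), Insens a E → Cls l F →
      avg (fun x => h x * ind (x ∈ E ∧ x ∈ F)) ≤ ε := by
  have hε3 : 0 < ε / 3 := by positivity
  obtain ⟨ν, hν, hT⟩ := hl η (ε / 3) hε3
  obtain ⟨ι, hι, hQ⟩ := insens_sub hα a ν (ε / 3) hε3
  set C : ℝ := (Nat.card (ι → α ⊕ Unit) : ℝ) with hC
  have hC1 : 1 ≤ C := by
    rw [hC]
    exact_mod_cast Nat.card_pos
  obtain ⟨c, hc⟩ : ∃ c, c = 1 / C := ⟨_, rfl⟩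
  have hc0 : 0 < c := by rw [hc]; positivity
  have hc1 : c ≤ 1 := by rw [hc, div_le_one (by positivity)]; exact hC1
  have hV : ∀ X : Set (ι → α ⊕ Unit), ∃ V : Set (ι → α ⊕ Unit), V ⊆ X ∧
      (Insens a X → ε / 3 ≤ dens X → c ≤ dens V) ∧
      ∀ h : (ι → α ⊕ Unit) → ℝ, Neg η h → ∀ F : Set (ι → α ⊕ Unit), Cls l F →
        avg (fun w => h w * ind (w ∈ V ∧ w ∈ F)) ≤ ε / 3 * dens V := by
    intro X
    by_cases hX : Insens a X ∧ ε / 3 ≤ dens X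
    · have hW := hQ X hX.1 hX.2
      unfold NoSub at hW
      push Not at hW
      obtain ⟨W, hW, hWX⟩ := hW
      have hd : dens (Set.range (ev W)) = (Nat.card (ν → α ⊕ Unit) / C : ℝ) := by
        have := avg_range (ev_injective hW) (fun _ => (1 : ℝ))
        simp only [one_mul, avg_const, mul_one] at this
        exact this
      refine ⟨Set.range (ev W), ?_, fun _ _ => ?_, fun h hh F hF => ?_⟩
      · rintro _ ⟨y, rfl⟩
        exact hWX y
      · rw [hd, hc]
        have : (1 : ℝ) ≤ Nat.card (ν → α ⊕ Unit) := by exact_mod_cast Nat.card_pos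
        gcongr
      · have h1 : ∀ w, h w * ind (w ∈ Set.range (ev W) ∧ w ∈ F) =
            (h w * ind (w ∈ F)) * ind (w ∈ Set.range (ev W)) := by
          intro w
          by_cases h1 : w ∈ Set.range (ev W) <;> by_cases h2 : w ∈ F <;> simp only [ind, h1, h2] <;> simp
        simp only [h1]
        rw [avg_range (ev_injective hW) (fun w => h w * ind (w ∈ F)), hd, mul_comm]
        gcongr
        exact hT _ (hh.pull hW) _ (Cls.pull W l F hF)
    · refine ⟨∅, Set.empty_subset _, fun h1 h2 => (hX ⟨h1, h2⟩).elim, fun h hh F hF => ?_⟩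
      simp only [Set.mem_empty_iff_false, false_and, ind_false not_false, mul_zero, avg_const]
      exact mul_nonneg hε3.le (dens_nonneg _)
  choose Vs hVs1 hVs2 hVs3 using hV
  have claim : ∀ j : ℕ, ∃ (κ : Type) (_ : Finite κ),
      ∀ h : (κ → α ⊕ Unit) → ℝ, Neg η h → ∀ E F : Set (κ → α ⊕ Unit), Insens a E → Cls l F →
      avg (fun x => h x * ind (x ∈ E ∧ x ∈ F)) ≤
        ((1 - c) ^ j + ε / 3) * dens E + (1 - (1 - c) ^ j) * (ε / 3) := by
    intro j
    induction j with
    | zero =>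
      refine ⟨Unit, inferInstance, fun h hh E F _ _ => ?_⟩
      have h1 : avg (fun x => h x * ind (x ∈ E ∧ x ∈ F)) ≤ dens E := by
        refine avg_mono fun x => ?_
        have h2 := ind_mono (fun h : x ∈ E ∧ x ∈ F => h.1)
        have h3 := ind_nonneg (x ∈ E ∧ x ∈ F)
        have h4 := hh.1 x
        nlinarith
      have h2 := mul_nonneg hε3.le (dens_nonneg E)
      simp only [pow_zero]
      linarith
    | succ j ih =>
      obtain ⟨κ, hκ, ih⟩ := ih
      refine ⟨ι ⊕ κ, inferInstance, fun h hh E F hE hF => ?_⟩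
      set r : ℝ := (1 - c) ^ j with hr
      have hr0 : 0 ≤ r := pow_nonneg (by linarith) _
      obtain ⟨Ez, hEz⟩ : ∃ Ez : (κ → α ⊕ Unit) → Set (ι → α ⊕ Unit),
        Ez = fun z => {w | Sum.elim w z ∈ E} := ⟨_, rfl⟩
      have hEz' : ∀ w z, w ∈ Ez z ↔ Sum.elim w z ∈ E := fun w z => by rw [hEz]; rfl
      have hEzins : ∀ z, Insens a (Ez z) := by
        intro z
        have := hE.pull (fixR z)
        simp only [ev_fixR] at this
        rw [hEz]
        exact this
      have hmgR : ∀ w z, (Sum.elim w (mg a z) ∈ E ↔ Sum.elim w z ∈ E) := by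
        intro w z
        refine hE.of_eq ?_
        funext i
        rcases i with i | i
        · rfl
        · simp only [mg, Sum.elim_inr]
          rcases z i <;> rfl
      have hEzmg : ∀ z, Ez (mg a z) = Ez z := by
        intro z
        ext w
        rw [hEz', hEz', hmgR]
      have hE'ins : ∀ w, Insens a {z : κ → α ⊕ Unit | Sum.elim w z ∈ E ∧ w ∉ Vs (Ez z)} := by
        intro w z
        simp only [Set.mem_ofPred_eq, hEzmg, hmgR]
      have hsplit : ∀ w z, ind (Sum.elim w z ∈ E ∧ Sum.elim w z ∈ F) =
          ind ((Sum.elim w z ∈ E ∧ w ∉ Vs (Ez z)) ∧ Sum.elim w z ∈ F) +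
          ind (w ∈ Vs (Ez z) ∧ Sum.elim w z ∈ F) := by
        intro w z
        have h0 : w ∈ Vs (Ez z) → Sum.elim w z ∈ E := fun h => (hEz' w z).1 (hVs1 _ h)
        by_cases h1 : w ∈ Vs (Ez z)
        · by_cases h2 : Sum.elim w z ∈ F <;> simp only [ind, h1, h0 h1, h2] <;> simp
        · by_cases h2 : Sum.elim w z ∈ F <;> by_cases h3 : Sum.elim w z ∈ E <;>
            simp only [ind, h1, h2, h3] <;> simp
      have hsplit2 : ∀ w z, ind (Sum.elim w z ∈ E) =
          ind (Sum.elim w z ∈ E ∧ w ∉ Vs (Ez z)) + ind (w ∈ Vs (Ez z)) := by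
        intro w z
        have h0 : w ∈ Vs (Ez z) → Sum.elim w z ∈ E := fun h => (hEz' w z).1 (hVs1 _ h)
        by_cases h1 : w ∈ Vs (Ez z)
        · simp only [ind, h1, h0 h1]; simp
        · by_cases h3 : Sum.elim w z ∈ E <;> simp only [ind, h1, h3] <;> simp
      set A : ℝ := avg fun w : ι → α ⊕ Unit =>
        dens {z : κ → α ⊕ Unit | Sum.elim w z ∈ E ∧ w ∉ Vs (Ez z)} with hA
      set B : ℝ := avg fun z : κ → α ⊕ Unit => dens (Vs (Ez z)) with hB
      have hAB : dens E = A + B := by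
        rw [dens, avg_sumElim, hA, hB]
        simp only [hsplit2, avg_add]
        unfold dens
        rw [avg_comm (fun (x : ι → α ⊕ Unit) (y : κ → α ⊕ Unit) => ind (x ∈ Vs (Ez y)))]
        rfl
      have hDz : dens E = avg fun z : κ → α ⊕ Unit => dens (Ez z) := by
        rw [dens, avg_sumElim, avg_comm]
        unfold dens
        simp only [hEz']
      have hBge : c * (dens E - ε / 3) ≤ B := by
        have h1 : ∀ z : κ → α ⊕ Unit, c * (dens (Ez z) - ε / 3) ≤ dens (Vs (Ez z)) := by
          intro z
          rcases le_total (ε / 3) (dens (Ez z)) with h2 | h2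
          · have h3 := hVs2 (Ez z) (hEzins z) h2
            have h4 := dens_le_one (Ez z)
            nlinarith
          · have h3 := dens_nonneg (Vs (Ez z))
            nlinarith
        have h2 := avg_mono h1
        rw [avg_mul_left, avg_sub, avg_const, ← hDz] at h2
        exact h2
      have hmain : avg (fun x => h x * ind (x ∈ E ∧ x ∈ F)) =
          avg (fun w : ι → α ⊕ Unit => avg fun z : κ → α ⊕ Unit => h (Sum.elim w z) *
            ind ((Sum.elim w z ∈ E ∧ w ∉ Vs (Ez z)) ∧ Sum.elim w z ∈ F)) +
          avg (fun z : κ → α ⊕ Unit => avg fun w : ι → α ⊕ Unit => h (Sum.elim w z) *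
            ind (w ∈ Vs (Ez z) ∧ Sum.elim w z ∈ F)) := by
        rw [avg_sumElim]
        simp only [hsplit, mul_add, avg_add]
        rw [avg_comm (fun (w : ι → α ⊕ Unit) (z : κ → α ⊕ Unit) => h (Sum.elim w z) *
            ind (w ∈ Vs (Ez z) ∧ Sum.elim w z ∈ F))]
      have hp1 : avg (fun w : ι → α ⊕ Unit => avg fun z : κ → α ⊕ Unit => h (Sum.elim w z) *
            ind ((Sum.elim w z ∈ E ∧ w ∉ Vs (Ez z)) ∧ Sum.elim w z ∈ F)) ≤
          (r + ε / 3) * A + (1 - r) * (ε / 3) := by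
        have h1 : ∀ w : ι → α ⊕ Unit, (avg fun z : κ → α ⊕ Unit => h (Sum.elim w z) *
            ind ((Sum.elim w z ∈ E ∧ w ∉ Vs (Ez z)) ∧ Sum.elim w z ∈ F)) ≤
            (r + ε / 3) * dens {z : κ → α ⊕ Unit | Sum.elim w z ∈ E ∧ w ∉ Vs (Ez z)} +
              (1 - r) * (ε / 3) := by
          intro w
          have h2 := hh.pull (V := fixL w) (fixL_proper (κ := κ) w)
          have h3 := Cls.pull (fixL (κ := κ) w) l F hF
          have h4 := ih _ h2 _ _ (hE'ins w) h3
          simpa only [ev_fixL, Set.mem_ofPred_eq] using h4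
        have h2 := avg_mono h1
        rwa [avg_add, avg_mul_left, avg_const] at h2
      have hp2 : avg (fun z : κ → α ⊕ Unit => avg fun w : ι → α ⊕ Unit => h (Sum.elim w z) *
            ind (w ∈ Vs (Ez z) ∧ Sum.elim w z ∈ F)) ≤ ε / 3 * B := by
        rw [hB, ← avg_mul_left]
        refine avg_mono fun z => ?_
        have h2 := hh.pull (V := fixR z) (fixR_proper (ι := ι) z)
        have h3 := Cls.pull (fixR (ι := ι) z) l F hF
        have h4 := hVs3 (Ez z) _ h2 _ h3
        simpa only [ev_fixR, Set.mem_ofPred_eq] using h4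
      rw [hmain, pow_succ, ← hr]
      have h5 : 0 ≤ r * (B - c * (dens E - ε / 3)) := mul_nonneg hr0 (by linarith)
      have hA' : A = dens E - B := by linarith
      rw [hA'] at hp1
      nlinarith
  obtain ⟨j, hj⟩ := exists_pow_lt_of_lt_one hε3 (show 1 - c < 1 by linarith)
  obtain ⟨κ, hκ, hfin⟩ := claim j
  refine ⟨κ, hκ, fun h hh E F hE hF => (hfin h hh E F hE hF).trans ?_⟩
  have h1 := dens_nonneg E
  have h2 := dens_le_one E
  have h3 : 0 ≤ (1 - c) ^ j := pow_nonneg (by linarith) _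
  nlinarith

lemma TT_all [Nonempty α] (hα : DHJ α) : ∀ l : List α, TT l
  | [] => TT_nil
  | a :: l => by
    intro η _ ε hε
    obtain ⟨ι, hι, hT⟩ := TT_inter hα a l (TT_all hα l) η (ε / 2) (half_pos hε)
    refine ⟨ι, hι, fun h hh F hF => ?_⟩
    obtain ⟨E, F₁, F₀, hE, h1, h0, hF⟩ := hF
    have hs : ∀ x, h x * ind (x ∈ F) =
        h x * ind (x ∈ E ∧ x ∈ F₁) + h x * ind (x ∈ Eᶜ ∧ x ∈ F₀) := by
      intro x
      rw [← mul_add]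
      congr 1
      have := hF x
      by_cases h1 : x ∈ E <;> by_cases h2 : x ∈ F₁ <;> by_cases h3 : x ∈ F₀ <;>
        simp only [ind, this, Set.mem_compl_iff, h1, h2, h3] <;> simp
    simp only [hs, avg_add]
    have := hT h hh E F₁ hE h1
    have := hT h hh Eᶜ F₀ hE.compl h0
    linarith

end Structured

/-! ### The Ramsey step -/

section Ramsey

variable {α : Type}

lemma comp_comp {γ ι η ζ ξ : Type} (V : ι → γ ⊕ η) (W : η → γ ⊕ ζ) (Y : ζ → γ ⊕ ξ) :
    comp (comp V W) Y = comp V (comp W Y) := by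
  funext i
  simp only [comp]
  rcases V i <;> rfl

lemma ramsey [Finite α] (η : Type) [Finite η] (ζ : Type) [Finite ζ] : ∀ (W : Type) [Finite W],
    ∃ (ι : Type) (_ : Finite ι), ∀ G : W → (ι → α ⊕ Unit) → Prop,
      (∃ w, ∃ V : ι → α ⊕ Option η, Proper V ∧
        ∀ u : η → α ⊕ Unit, G w (comp V (fun o => o.elim (Sum.inr ()) u))) ∨
      (∃ U : ι → α ⊕ ζ, Proper U ∧ ∀ w, ∀ y : ζ → α ⊕ Unit, Proper y → ¬ G w (comp U y)) := by
  refine Finite.induction_empty_option (P := fun ζ : Type => ∀ (W : Type) [Finite W],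
    ∃ (ι : Type) (_ : Finite ι), ∀ G : W → (ι → α ⊕ Unit) → Prop,
      (∃ w, ∃ V : ι → α ⊕ Option η, Proper V ∧
        ∀ u : η → α ⊕ Unit, G w (comp V (fun o => o.elim (Sum.inr ()) u))) ∨
      (∃ U : ι → α ⊕ ζ, Proper U ∧ ∀ w, ∀ y : ζ → α ⊕ Unit, Proper y → ¬ G w (comp U y)))
    ?_ ?_ ?_ ζ
  · intro ζ ζ' e ih W _
    obtain ⟨ι, hι, h⟩ := ih W
    refine ⟨ι, hι, fun G => (h G).imp id ?_⟩
    rintro ⟨U, hU, hb⟩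
    refine ⟨fun i => Sum.map id e (U i), ?_, ?_⟩
    · intro f
      obtain ⟨i, hi⟩ := hU (e.symm f)
      exact ⟨i, by simp [hi]⟩
    · intro w y hy
      have heq : comp (fun i => Sum.map id e (U i)) y = comp U (fun j => y (e j)) := by
        funext i
        simp only [comp]
        rcases U i <;> rfl
      rw [heq]
      refine hb w _ ?_
      intro o
      obtain ⟨i, hi⟩ := hy o
      exact ⟨e.symm i, by simp [hi]⟩
  · intro W _
    refine ⟨PEmpty, inferInstance, fun G => Or.inr ⟨fun i => i.elim, fun e => e.elim, ?_⟩⟩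
    intro w y hy
    obtain ⟨i, -⟩ := hy ()
    exact i.elim
  · intro ζ _ ih W _
    obtain ⟨ι', hι', ih⟩ := ih (W × α)
    obtain ⟨ι'', hι'', hHJ⟩ := Combinatorics.Subspace.exists_mono_in_high_dimension
      (α ⊕ Unit) (W → Prop) (η ⊕ ι')
    refine ⟨Option ι'', inferInstance, fun G => ?_⟩
    obtain ⟨L, c, hc⟩ := hHJ (fun u w => G w (fun o => o.elim (Sum.inr ()) u))
    obtain ⟨Q, hQ⟩ : ∃ Q : Option ι'' → α ⊕ Option (η ⊕ ι'), Q = fun o => o.elim (Sum.inr none)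
      (fun j => Sum.elim (Sum.elim Sum.inl (fun _ => Sum.inr none)) (fun e => Sum.inr (some e))
        (L.idxFun j)) := ⟨_, rfl⟩
    have hQp : Proper Q := by
      rintro (_ | e)
      · exact ⟨none, by rw [hQ]; rfl⟩
      · obtain ⟨i, hi⟩ := L.proper e
        exact ⟨some i, by rw [hQ]; simp [hi]⟩
    have hQc : ∀ w, ∀ y : Option (η ⊕ ι') → α ⊕ Unit, y none = Sum.inr () →
        (G w (comp Q y) ↔ c w) := by
      intro w y hy
      rw [← hc (fun e => y (some e))]
      have heq : comp Q y = fun o => o.elim (Sum.inr ()) (L fun e => y (some e)) := by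
        funext o
        rcases o with _ | j
        · simp [comp, hQ, hy]
        · simp only [comp, hQ, Option.elim_some, Combinatorics.Subspace.apply_def]
          rcases L.idxFun j with (b | b) | e
          · rfl
          · simp [hy]
          · rfl
      rw [heq]
    by_cases hex : ∃ w, c w
    · obtain ⟨w, hw⟩ := hex
      left
      refine ⟨w, comp Q (fun o => o.elim (Sum.inr none)
        (Sum.elim (fun e => Sum.inr (some e)) (fun _ => Sum.inr none))), hQp.comp ?_, ?_⟩
      · rintro (_ | e)
        · exact ⟨none, rfl⟩
        · exact ⟨some (Sum.inl e), rfl⟩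
      · intro u
        rw [comp_comp, hQc]
        · exact hw
        · rfl
    · push Not at hex
      obtain ⟨R, hR⟩ : ∃ R : α → Option (η ⊕ ι') → α ⊕ ι', R = fun a o => o.elim (Sum.inl a)
        (Sum.elim (fun _ => Sum.inl a) Sum.inr) := ⟨_, rfl⟩
      have hRp : ∀ a, Proper (R a) := fun a e => ⟨some (Sum.inr e), by rw [hR]; rfl⟩
      rcases ih (fun p y => G p.1 (comp (comp Q (R p.2)) y)) with ⟨⟨w, a⟩, V, hV, hg⟩ | ⟨U, hU, hb⟩
      · left
        refine ⟨w, comp (comp Q (R a)) V, (hQp.comp (hRp a)).comp hV, fun u => ?_⟩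
        rw [comp_comp]
        exact hg u
      · right
        refine ⟨comp Q (fun o => o.elim (Sum.inr none)
          (Sum.elim (fun _ => Sum.inr none) (fun i => Sum.map id some (U i)))), hQp.comp ?_, ?_⟩
        · rintro (_ | e)
          · exact ⟨none, rfl⟩
          · obtain ⟨i, hi⟩ := hU e
            exact ⟨some (Sum.inr i), by simp [hi]⟩
        · intro w y hy
          rw [comp_comp]
          rcases hy0 : y none with a | o
          · have h1 : Proper (fun e => y (some e)) := by
              intro o
              obtain ⟨i, hi⟩ := hy o
              rcases i with _ | i
              · rw [hy0] at hi
                cases hi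
              · exact ⟨i, hi⟩
            have h2 := hb (w, a) _ h1
            simp only [comp_comp] at h2
            convert h2 using 3
            funext o
            rcases o with _ | e | i
            · simp [comp, hR, hy0]
            · simp [comp, hR, hy0]
            · simp only [comp, hR, Option.elim_some, Sum.elim_inr]
              rcases U i <;> rfl
          · rw [hQc]
            · exact hex w
            · simp [comp, hy0]

end Ramsey

/-! ### The density Hales-Jewett theorem -/

section Main

lemma dhj_step {α : Type} [Finite α] [Nonempty α] (hα : DHJ α) : DHJ (α ⊕ Unit) := by
  intro ε hε
  by_contra! hcon
  obtain ⟨δ, hδ, hup, hfib⟩ := extremal (γ := α ⊕ Unit) (fun ι E => NoSub Unit E)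
      (fun ι ζ A V hV hA => hA.pull hV) (ε := ε)
      (fun ι hι => by
        obtain ⟨E, h1, h2⟩ := hcon ι hι
        exact ⟨E, h2, h1⟩)
  have hδ0 : 0 < δ := hε.trans_le hδ
  obtain ⟨ι₀, hι₀, θ₁, hθ₁, hprob⟩ := probDHJ hα (half_pos hδ0)
  obtain ⟨θ, hθ0, hθ1, hθle⟩ : ∃ θ : ℝ, 0 < θ ∧ θ ≤ 1 ∧ θ ≤ θ₁ :=
    ⟨min θ₁ 1, by positivity, min_le_right _ _, min_le_left _ _⟩
  obtain ⟨s, hs⟩ : ∃ s, s = δ * θ / 4 := ⟨_, rfl⟩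
  have hs0 : 0 < s := by rw [hs]; positivity
  have hsδ : s ≤ δ / 2 := by rw [hs]; nlinarith
  obtain ⟨N, hN, hNd⟩ := hup s hs0
  let := Fintype.ofFinite α
  obtain ⟨η, hη, hT⟩ := TT_all hα (Finset.univ : Finset α).toList N s hs0
  obtain ⟨ι, hι, hram⟩ := ramsey (α := α) η ι₀ Unit
  obtain ⟨κ₀, hκ₀, A, hA, hAfib⟩ := hfib ι Empty s hs0
  rcases hram (fun _ y => θ ≤ avg fun z : Empty ⊕ κ₀ → α ⊕ Unit =>
    ind (∀ i : Unit → α, Sum.elim (fun j => (Sum.inl (ev y i j) : α ⊕ Unit)) z ∈ A)) with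
    ⟨-, V, hV, hg⟩ | ⟨U, hU, hb⟩
  · obtain ⟨Y, hY⟩ : ∃ Y : (η → α ⊕ Unit) → ι → α ⊕ Unit,
      Y = fun u => comp V (fun o => o.elim (Sum.inr ()) u) := ⟨_, rfl⟩
    have hYp : ∀ u, Proper (Y u) := by
      rintro u ⟨⟩
      obtain ⟨i, hi⟩ := hV none
      exact ⟨i, by simp [hY, comp, hi]⟩
    have hg' : ∀ u, θ ≤ avg fun z : Empty ⊕ κ₀ → α ⊕ Unit =>
      ind (∀ i : Unit → α, Sum.elim (fun j => (Sum.inl (ev (Y u) i j) : α ⊕ Unit)) z ∈ A) := by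
      intro u
      rw [hY]
      exact hg u
    have hz : ∃ z : Empty ⊕ κ₀ → α ⊕ Unit, δ - s + δ * θ ≤ dens {u | Sum.elim (Y u) z ∈ A} +
        δ * dens {u | ∀ i : Unit → α,
          Sum.elim (fun j => (Sum.inl (ev (Y u) i j) : α ⊕ Unit)) z ∈ A} := by
      obtain ⟨z, hz⟩ := exists_avg_le (fun z : Empty ⊕ κ₀ → α ⊕ Unit =>
        dens {u | Sum.elim (Y u) z ∈ A} + δ * dens {u | ∀ i : Unit → α,
          Sum.elim (fun j => (Sum.inl (ev (Y u) i j) : α ⊕ Unit)) z ∈ A})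
      refine ⟨z, le_trans ?_ hz⟩
      rw [avg_add, avg_mul_left]
      unfold dens
      rw [avg_comm, avg_comm (fun (z : Empty ⊕ κ₀ → α ⊕ Unit) u => ind (u ∈ {u | ∀ i : Unit → α,
          Sum.elim (fun j => (Sum.inl (ev (Y u) i j) : α ⊕ Unit)) z ∈ A}))]
      gcongr
      · exact const_le_avg fun u => hAfib (Y u)
      · exact const_le_avg fun u => hg' u
    obtain ⟨z, hz⟩ := hz
    set B : Set (η → α ⊕ Unit) := {u | Sum.elim (Y u) z ∈ A} with hB
    set DD : Set (η → α ⊕ Unit) := {u | ∀ i : Unit → α,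
          Sum.elim (fun j => (Sum.inl (ev (Y u) i j) : α ⊕ Unit)) z ∈ A} with hDD
    obtain ⟨D, hD⟩ : ∃ D : α → Set (η → α ⊕ Unit), D = fun a => {u |
          Sum.elim (fun j => (Sum.inl (ev (Y u) (fun _ => a) j) : α ⊕ Unit)) z ∈ A} := ⟨_, rfl⟩
    have hDins : ∀ a, Insens a (D a) := by
      intro a u
      have heq : ev (Y (mg a u)) (fun _ => a) = ev (Y u) (fun _ => a) := by
        funext j
        simp only [hY, ev, comp]
        rcases V j with b | _ | e
        · rfl
        · rfl
        · simp only [Sum.elim_inr, Option.elim_some, mg]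
          rcases u e <;> rfl
      rw [hD]
      simp only [Set.mem_ofPred_eq, heq]
    have hDDiff : ∀ u, u ∈ DD ↔ ¬ ∃ a ∈ (Finset.univ : Finset α).toList, u ∉ D a := by
      intro u
      simp only [hDD, hD, Set.mem_ofPred_eq, Finset.mem_toList, Finset.mem_univ, true_and, not_exists,
        not_not]
      exact ⟨fun h a => h fun _ => a, fun h i => h (i ())⟩
    have hdisj : ∀ u, u ∈ B → u ∉ DD := by
      intro u h1 h2
      obtain ⟨y, hy⟩ := hA (Sum.elim (fun j => Sum.map Sum.inl id (Y u j)) (fun j => Sum.inl (z j)))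
        (by
          intro o
          obtain ⟨i, hi⟩ := hYp u o
          exact ⟨Sum.inl i, by simp [hi]⟩)
      apply hy
      rcases hy0 : y () with a | o
      · convert h2 (fun _ => a) using 1
        funext j
        rcases j with j | j
        · simp only [ev, Sum.elim_inl]
          rcases Y u j with b | b
          · rfl
          · exact hy0
        · rfl
      · have h1' : Sum.elim (Y u) z ∈ A := h1
        convert h1' using 1
        funext j
        rcases j with j | j
        · simp only [ev, Sum.elim_inl]
          rcases Y u j with b | b
          · rfl
          · exact hy0
        · rfl
    have hBno : NoSub Unit B := by
      have h1 := hA.pull (V := (Sum.elim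
        (fun j => Sum.elim (fun a => Sum.inl (Sum.inl a))
          (fun o => o.elim (Sum.inl (Sum.inr ())) Sum.inr) (V j)) (fun j => Sum.inl (z j)) :
          ι ⊕ (Empty ⊕ κ₀) → (α ⊕ Unit) ⊕ η)) (by
          intro e
          obtain ⟨i, hi⟩ := hV (some e)
          exact ⟨Sum.inl i, by simp [hi]⟩)
      convert h1 using 1
      ext u
      simp only [hB, Set.mem_ofPred_eq]
      refine iff_of_eq (congrArg (· ∈ A) ?_)
      funext j
      rcases j with j | j
      · simp only [hY, ev, comp, Sum.elim_inl]
        rcases V j with b | _ | e <;> rfl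
      · rfl
    have hneg : Neg N (fun u => ind (u ∈ B) - (δ + s)) := by
      refine ⟨fun u => ?_, fun W hW => ?_⟩
      · have := ind_le_one (u ∈ B)
        linarith
      · rw [avg_sub, avg_const]
        have := hNd _ (hBno.pull hW)
        unfold dens at this
        simp only [Set.mem_ofPred_eq] at this
        linarith
    have hfin := hT _ hneg _ (Cls.not_all D hDins _)
    have hpt : ∀ u, (ind (u ∈ B) - (δ + s)) *
        ind (u ∈ {x | ∃ a ∈ (Finset.univ : Finset α).toList, x ∉ D a}) =
        ind (u ∈ B) - (δ + s) * (1 - ind (u ∈ DD)) := by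
      intro u
      by_cases h1 : u ∈ DD
      · have h2 : u ∉ B := fun h => hdisj u h h1
        rw [ind_true h1, ind_false h2, ind_false (show u ∉ {x | ∃ a ∈ (Finset.univ : Finset α).toList, x ∉ D a} from (hDDiff u).1 h1)]
        ring
      · have h2 : u ∈ {x | ∃ a ∈ (Finset.univ : Finset α).toList, x ∉ D a} := by
          by_contra h3
          exact h1 ((hDDiff u).2 h3)
        rw [ind_false h1, ind_true h2]
        ring
    simp only [hpt] at hfin
    rw [avg_sub, avg_mul_left, avg_sub, avg_const] at hfin
    change dens B - (δ + s) * (1 - dens DD) ≤ s at hfin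
    have h1 := dens_nonneg DD
    nlinarith
  · obtain ⟨t, ht, htθ⟩ := hprob (Empty ⊕ κ₀ → α ⊕ Unit)
      (fun z => {w | Sum.elim (fun j => Sum.inl (ev U w j)) z ∈ A}) (fun w => by
        have h1 := hAfib (fun j => Sum.inl (ev U w j))
        have h2 : δ / 2 ≤ δ - s := by linarith
        exact h2.trans h1)
    refine hb () t ht (hθle.trans ?_)
    simpa only [ev_comp, Set.mem_ofPred_eq] using htθ

lemma dhj_equiv {α β : Type} [Finite α] [Finite β] (e : α ≃ β) (h : DHJ α) : DHJ β := by
  intro ε hε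
  obtain ⟨ι, hι, hA⟩ := h ε hε
  refine ⟨ι, hι, fun A hd hno => ?_⟩
  refine hA {x | (fun i => e (x i)) ∈ A} ?_ ?_
  · have := avg_equiv (Equiv.arrowCongr (Equiv.refl ι) e) (fun x => ind (x ∈ A))
    refine hd.trans (le_of_eq ?_)
    rw [dens, ← this]
    rfl
  · intro V hV
    obtain ⟨y, hy⟩ := hno (fun i => Sum.map e id (V i)) (by
      intro o
      obtain ⟨i, hi⟩ := hV o
      exact ⟨i, by simp [hi]⟩)
    refine ⟨fun o => e.symm (y o), fun hmem => hy ?_⟩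
    have hmem' : (fun i => e (ev V (fun o => e.symm (y o)) i)) ∈ A := hmem
    convert hmem' using 1
    funext i
    simp only [ev]
    rcases V i with b | o <;> simp

theorem dhj (k : ℕ) : DHJ (Fin (k + 1)) := by
  induction k with
  | zero =>
    intro ε hε
    refine ⟨Unit, inferInstance, fun A hA hno => ?_⟩
    obtain ⟨x, hx⟩ := nonempty_of_dens_pos (hε.trans_le hA)
    obtain ⟨y, hy⟩ := hno Sum.inr (fun e => ⟨e, rfl⟩)
    have he : ev Sum.inr y = x := by
      funext i
      exact Subsingleton.elim (α := Fin 1) _ _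
    exact hy (he ▸ hx)
  | succ k ih =>
    exact dhj_equiv (Fintype.equivOfCardEq (by simp)) (dhj_step ih)

end Main

section Szemeredi

lemma sum_ind {X : Type} (I : Finset X) (P : X → Prop) [DecidablePred P] :
    ∑ x ∈ I, ind (P x) = ((I.filter P).card : ℝ) := by
  rw [Finset.card_filter]
  push_cast
  refine Finset.sum_congr rfl fun x _ => ?_
  by_cases h : P x
  · rw [ind_true h, if_pos h]
  · rw [ind_false h, if_neg h]

variable {ι : Type} [Fintype ι] {k : ℕ}

/-- The digit sum of a word. -/
def dsum (w : ι → Fin (k + 1)) : ℤ := ∑ i, ((w i : ℕ) : ℤ)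

/-- The digit sum of the fixed part of a template. -/
def fixedSum (t : ι → Fin (k + 1) ⊕ Unit) : ℤ :=
  ∑ i, Sum.elim (fun a : Fin (k + 1) => ((a : ℕ) : ℤ)) (fun _ => 0) (t i)

/-- The number of wildcards of a template. -/
def wild (t : ι → Fin (k + 1) ⊕ Unit) : ℤ :=
  ∑ i, Sum.elim (fun _ : Fin (k + 1) => (0 : ℤ)) (fun _ => 1) (t i)

lemma dsum_nonneg (w : ι → Fin (k + 1)) : 0 ≤ dsum w :=
  Finset.sum_nonneg fun i _ => by positivity

lemma dsum_le (w : ι → Fin (k + 1)) : dsum w ≤ Fintype.card ι * k := by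
  have : dsum w ≤ ∑ _i : ι, (k : ℤ) := by
    refine Finset.sum_le_sum fun i _ => ?_
    have := (w i).is_lt
    omega
  simpa using this

lemma dsum_ev (t : ι → Fin (k + 1) ⊕ Unit) (j : Fin (k + 1)) :
    dsum (ev t (fun _ => j)) = fixedSum t + ((j : ℕ) : ℤ) * wild t := by
  unfold dsum fixedSum wild
  rw [Finset.mul_sum, ← Finset.sum_add_distrib]
  refine Finset.sum_congr rfl fun i _ => ?_
  simp only [ev]
  rcases t i with a | o <;> simp

lemma wild_pos {t : ι → Fin (k + 1) ⊕ Unit} (ht : Proper t) : 1 ≤ wild t := by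
  obtain ⟨i, hi⟩ := ht ()
  have := Finset.single_le_sum
    (f := fun i => Sum.elim (fun _ : Fin (k + 1) => (0 : ℤ)) (fun _ => 1) (t i))
    (fun i _ => by rcases t i with a | o <;> simp) (Finset.mem_univ i)
  simpa [hi, wild] using this

lemma wild_le (t : ι → Fin (k + 1) ⊕ Unit) : wild t ≤ Fintype.card ι := by
  have : wild t ≤ ∑ _i : ι, (1 : ℤ) := by
    refine Finset.sum_le_sum fun i _ => ?_
    rcases t i with a | o <;> simp
  simpa using this

/-- Number of progressions in `A` with difference `D`. -/
noncomputable def cnt (k N : ℕ) (A : Finset ℤ) (D : ℤ) : ℝ :=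
  ∑ x ∈ Finset.Icc (1 : ℤ) N, ind (∀ j ∈ Finset.range (k + 1), x + (j : ℤ) * D ∈ A)

lemma cnt_nonneg (k N : ℕ) (A : Finset ℤ) (D : ℤ) : 0 ≤ cnt k N A D :=
  Finset.sum_nonneg fun _ _ => ind_nonneg _

lemma card_le_window {N : ℕ} {A I : Finset ℤ} {s K : ℤ} (hA : A ⊆ Finset.Icc (1 : ℤ) N)
    (hI : I = Finset.Icc (1 - K) (N : ℤ)) (h0 : 0 ≤ s) (h1 : s ≤ K) :
    (A.card : ℝ) ≤ ∑ x ∈ I, ind (x + s ∈ A) := by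
  classical
  rw [sum_ind]
  have : A.card = (A.image (fun x => x - s)).card :=
    (Finset.card_image_of_injective _ (fun a b h => by simpa using h)).symm
  rw [this]
  refine Nat.cast_le.2 (Finset.card_le_card ?_)
  intro y hy
  obtain ⟨x, hx, rfl⟩ := Finset.mem_image.1 hy
  have := Finset.mem_Icc.1 (hA hx)
  rw [Finset.mem_filter, hI, Finset.mem_Icc]
  exact ⟨⟨by linarith, by linarith⟩, by simpa using hx⟩

lemma window_le_cnt {N : ℕ} {A I : Finset ℤ} (hA : A ⊆ Finset.Icc (1 : ℤ) N) (d : ℤ)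
    (t : ι → Fin (k + 1) ⊕ Unit) :
    ∑ x ∈ I, ind (Proper t ∧ ∀ i : Unit → Fin (k + 1), x + dsum (ev t i) * d ∈ A) ≤
      cnt k N A (wild t * d) := by
  classical
  unfold cnt
  rw [sum_ind, sum_ind]
  refine Nat.cast_le.2 (Finset.card_le_card_of_injOn (fun x => x + fixedSum t * d) ?_ ?_)
  · intro x hx
    obtain ⟨-, -, hx⟩ := Finset.mem_filter.1 hx
    have key : ∀ j ∈ Finset.range (k + 1),
        x + fixedSum t * d + (j : ℤ) * (wild t * d) ∈ A := by
      intro j hj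
      have := hx (fun _ => ⟨j, Finset.mem_range.1 hj⟩)
      rw [dsum_ev] at this
      convert this using 1
      ring
    refine Finset.mem_coe.2 (Finset.mem_filter.2 ⟨?_, key⟩)
    have := hA (key 0 (by simp))
    simpa using this
  · intro a _ b _ h
    simpa using h

lemma sum_cnt_le {N M : ℕ} {A : Finset ℤ} {r : ℤ} (h1 : 1 ≤ r) (h2 : r * M ≤ N) :
    ∑ d ∈ Finset.Icc (1 : ℤ) M, cnt k N A (r * d) ≤ ∑ D ∈ Finset.Icc (1 : ℤ) N, cnt k N A D := by
  classical
  have : ∑ d ∈ Finset.Icc (1 : ℤ) M, cnt k N A (r * d) =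
      ∑ D ∈ (Finset.Icc (1 : ℤ) M).image (fun d => r * d), cnt k N A D := by
    rw [Finset.sum_image]
    intro a _ b _ h
    exact mul_left_cancel₀ (by omega) h
  rw [this]
  refine Finset.sum_le_sum_of_subset_of_nonneg ?_ fun _ _ _ => cnt_nonneg _ _ _ _
  intro y hy
  obtain ⟨d, hd, rfl⟩ := Finset.mem_image.1 hy
  rw [Finset.mem_Icc] at hd ⊢
  constructor <;> nlinarith

lemma dens_le_sum {ε : ℝ} [Finite (ι → Fin (k + 1) ⊕ Unit)] [Fintype (ι → Fin (k + 1) ⊕ Unit)]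
    (hε : 0 ≤ ε)
    (hA : ∀ A : Set (ι → Fin (k + 1)), ε ≤ dens A → ¬ NoSub Unit A) (S : Set (ι → Fin (k + 1))) :
    dens S ≤ ε + ∑ t : ι → Fin (k + 1) ⊕ Unit,
      ind (Proper t ∧ ∀ i : Unit → Fin (k + 1), ev t i ∈ S) := by
  have hnn : ∀ t : ι → Fin (k + 1) ⊕ Unit,
      0 ≤ ind (Proper t ∧ ∀ i : Unit → Fin (k + 1), ev t i ∈ S) := fun t => ind_nonneg _
  rcases le_total (dens S) ε with hz | hz
  · have := Finset.sum_nonneg fun t (_ : t ∈ Finset.univ) => hnn t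
    linarith
  · have := hA _ hz
    unfold NoSub at this
    push Not at this
    obtain ⟨t, ht, ht'⟩ := this
    have h3 := Finset.single_le_sum (fun t _ => hnn t) (Finset.mem_univ t)
    rw [ind_true ⟨ht, ht'⟩] at h3
    have := dens_le_one S
    linarith

lemma count_lower {ε : ℝ} [Fintype (ι → Fin (k + 1) ⊕ Unit)] (hε : 0 ≤ ε)
    (hdhj : ∀ A : Set (ι → Fin (k + 1)), ε ≤ dens A → ¬ NoSub Unit A)
    {N M : ℕ} {A : Finset ℤ} (hA : A ⊆ Finset.Icc (1 : ℤ) N)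
    (hM1 : Fintype.card ι * M ≤ N) (hM2 : Fintype.card ι * k * M ≤ N) :
    (M : ℝ) * A.card ≤ M * (ε * (2 * N)) + Fintype.card (ι → Fin (k + 1) ⊕ Unit) *
      ∑ D ∈ Finset.Icc (1 : ℤ) N, cnt k N A D := by
  classical
  set K : ℤ := Fintype.card ι * k * M with hK
  set I := Finset.Icc (1 - K) (N : ℤ) with hI
  have hKN : K ≤ N := by rw [hK]; exact_mod_cast hM2
  have hK0 : 0 ≤ K := by rw [hK]; positivity
  have hIcard : (I.card : ℝ) ≤ 2 * N := by
    rw [hI, Int.card_Icc]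
    have : ((N : ℤ) + 1 - (1 - K)).toNat ≤ 2 * N := by omega
    exact_mod_cast this
  have step : ∀ d ∈ Finset.Icc (1 : ℤ) M, (A.card : ℝ) ≤ ε * (2 * N) +
      ∑ t : ι → Fin (k + 1) ⊕ Unit, ∑ x ∈ I,
        ind (Proper t ∧ ∀ i : Unit → Fin (k + 1), x + dsum (ev t i) * d ∈ A) := by
    intro d hd
    rw [Finset.mem_Icc] at hd
    have h1 : (A.card : ℝ) ≤ ∑ x ∈ I, dens {w : ι → Fin (k + 1) | x + dsum w * d ∈ A} := by
      have e : ∑ x ∈ I, dens {w : ι → Fin (k + 1) | x + dsum w * d ∈ A} =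
          avg (fun w : ι → Fin (k + 1) => ∑ x ∈ I, ind (x + dsum w * d ∈ A)) := by
        unfold dens
        simp only [avg_eq, ← Finset.sum_div]
        rw [Finset.sum_comm]
        rfl
      rw [e]
      refine const_le_avg fun w => ?_
      have a1 := dsum_nonneg w
      have a2 := dsum_le w
      refine card_le_window hA hI (by nlinarith) ?_
      rw [hK]
      exact mul_le_mul a2 hd.2 (by linarith) (by positivity)
    have h2 := Finset.sum_le_sum fun x (_ : x ∈ I) =>
      dens_le_sum hε hdhj {w : ι → Fin (k + 1) | x + dsum w * d ∈ A}
    rw [Finset.sum_add_distrib, Finset.sum_comm] at h2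
    have h3 : ∑ _x ∈ I, ε ≤ ε * (2 * N) := by
      rw [Finset.sum_const, nsmul_eq_mul, mul_comm]
      gcongr
    exact (h1.trans h2).trans (add_le_add h3 le_rfl)
  have h4 := Finset.sum_le_sum step
  rw [Finset.sum_add_distrib, Finset.sum_const, Finset.sum_const, Int.card_Icc, Finset.sum_comm,
    nsmul_eq_mul, nsmul_eq_mul] at h4
  have hMc : ((M : ℤ) + 1 - 1).toNat = M := by omega
  rw [hMc] at h4
  refine h4.trans (add_le_add le_rfl ?_)
  have h5 : ∀ t ∈ (Finset.univ : Finset (ι → Fin (k + 1) ⊕ Unit)),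
      ∑ d ∈ Finset.Icc (1 : ℤ) M, ∑ x ∈ I,
        ind (Proper t ∧ ∀ i : Unit → Fin (k + 1), x + dsum (ev t i) * d ∈ A) ≤
      ∑ D ∈ Finset.Icc (1 : ℤ) N, cnt k N A D := by
    intro t _
    by_cases ht : Proper t
    · refine (Finset.sum_le_sum fun d _ => window_le_cnt hA d t).trans ?_
      refine sum_cnt_le (wild_pos ht) ?_
      have := wild_le t
      calc wild t * M ≤ Fintype.card ι * M := by gcongr
        _ ≤ N := by exact_mod_cast hM1
    · refine le_trans (le_of_eq ?_) (Finset.sum_nonneg fun D _ => cnt_nonneg k N A D)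
      refine Finset.sum_eq_zero fun d _ => Finset.sum_eq_zero fun x _ => ?_
      exact ind_false fun h => ht h.1
  refine (Finset.sum_le_sum h5).trans (le_of_eq ?_)
  rw [Finset.sum_const, nsmul_eq_mul, Finset.card_univ]

end Szemeredi

end SZ


/-- **Functional form of Szemerédi's theorem.** For every `k ≥ 1` and `δ > 0` there are
`c(k,δ) > 0` and a threshold `N₀(k,δ)` such that for every `N ≥ N₀` and every
`f : [N] → [0,1]` (extended by zero) with `E_{x ∈ [N]} f(x) ≥ δ`, one has
`AP_k(f) = E_{x,d ∈ [N]} f(x) f(x+d) ⋯ f(x+kd) ≥ c(k,δ)`. -/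
theorem szemeredi_functional (k : ℕ) (hk : 1 ≤ k) (δ : ℝ) (hδ : 0 < δ) :
    ∃ c : ℝ, 0 < c ∧ ∃ N₀ : ℕ, ∀ N : ℕ, N₀ ≤ N → ∀ f : ℤ → ℝ,
      (∀ x, 0 ≤ f x ∧ f x ≤ 1) →
      (∀ x, x ∉ Finset.Icc (1 : ℤ) (N : ℤ) → f x = 0) →
      δ ≤ (N : ℝ)⁻¹ * ∑ x ∈ Finset.Icc (1 : ℤ) (N : ℤ), f x →
      c ≤ ((N : ℝ) ^ 2)⁻¹ * ∑ x ∈ Finset.Icc (1 : ℤ) (N : ℤ),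
        ∑ d ∈ Finset.Icc (1 : ℤ) (N : ℤ), ∏ j ∈ Finset.range (k + 1), f (x + (j : ℤ) * d) := by
  classical
  obtain ⟨ι, hι, hdhj⟩ := SZ.dhj k (δ / 8) (by positivity)
  let := Fintype.ofFinite ι
  let : Fintype (ι → Fin (k + 1) ⊕ Unit) := Fintype.ofFinite _
  set L := Fintype.card (ι → Fin (k + 1) ⊕ Unit) with hL
  have hL0 : (0 : ℝ) < L := by exact_mod_cast Fintype.card_pos
  set n := Fintype.card ι with hn
  set q : ℕ := k * (n + 1) with hq
  have hq0 : 0 < q := by positivity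
  have hq0' : (0 : ℝ) < q := by exact_mod_cast hq0
  refine ⟨(δ / 2) ^ (k + 1) * (δ / (8 * q * L)), by positivity, 2 * q, ?_⟩
  intro N hN f hf hf0 hδf
  have hN0 : (0 : ℝ) < N := by
    have : 0 < N := by omega
    exact_mod_cast this
  set A := (Finset.Icc (1 : ℤ) N).filter (fun x => δ / 2 ≤ f x) with hA
  set M := N / q with hM
  have hMq : q * M ≤ N := Nat.mul_div_le N q
  have hMq2 : N < q * M + q := Nat.lt_mul_div_succ N hq0
  have hM2 : (N : ℝ) ≤ 2 * q * M := by
    have : N ≤ 2 * (q * M) := by omega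
    rw [mul_assoc]
    exact_mod_cast this
  have hqM : q * M = n * k * M + k * M := by rw [hq]; ring
  have h1 := SZ.count_lower (k := k) (ε := δ / 8) (by positivity) hdhj (N := N) (M := M) (A := A)
    (Finset.filter_subset _ _) (by nlinarith [Nat.zero_le (n * M), Nat.zero_le (k * M)]) (by
      rw [← hn]; omega)
  rw [← hL] at h1
  have hAc : δ / 2 * N ≤ A.card := by
    have a1 : δ * N ≤ ∑ x ∈ Finset.Icc (1 : ℤ) (N : ℤ), f x := by
      rw [inv_mul_eq_div, le_div_iff₀ hN0] at hδf
      exact hδf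
    have a2 : ∑ x ∈ Finset.Icc (1 : ℤ) (N : ℤ), f x ≤
        ∑ x ∈ Finset.Icc (1 : ℤ) (N : ℤ), (δ / 2 + SZ.ind (δ / 2 ≤ f x)) := by
      refine Finset.sum_le_sum fun x _ => ?_
      by_cases h : δ / 2 ≤ f x
      · rw [SZ.ind_true h]
        have := (hf x).2
        linarith
      · rw [SZ.ind_false h]
        linarith
    rw [Finset.sum_add_distrib, SZ.sum_ind, Finset.sum_const, Int.card_Icc, nsmul_eq_mul,
      ← hA] at a2
    have : ((N : ℤ) + 1 - 1).toNat = N := by omega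
    rw [this] at a2
    linarith
  set H := ∑ D ∈ Finset.Icc (1 : ℤ) N, SZ.cnt k N A D with hH
  have h2 : δ * N ^ 2 / (8 * q * L) ≤ H := by
    rw [div_le_iff₀ (by positivity)]
    have b1 : (M : ℝ) * (δ / 2 * N) ≤ M * A.card := by gcongr
    have b2 : (M : ℝ) * δ * N ≤ 4 * L * H := by nlinarith
    have b3 : (N : ℝ) * (δ * N) ≤ 2 * q * M * (δ * N) := by gcongr
    have b4 : 2 * (q : ℝ) * (M * δ * N) ≤ 2 * q * (4 * L * H) := by gcongr
    nlinarith
  have h3 : (δ / 2) ^ (k + 1) * H ≤ ∑ x ∈ Finset.Icc (1 : ℤ) (N : ℤ),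
      ∑ d ∈ Finset.Icc (1 : ℤ) (N : ℤ), ∏ j ∈ Finset.range (k + 1), f (x + (j : ℤ) * d) := by
    rw [Finset.sum_comm, hH, Finset.mul_sum]
    refine Finset.sum_le_sum fun D _ => ?_
    rw [SZ.cnt, Finset.mul_sum]
    refine Finset.sum_le_sum fun x _ => ?_
    by_cases h : ∀ j ∈ Finset.range (k + 1), x + (j : ℤ) * D ∈ A
    · rw [SZ.ind_true h, mul_one]
      have := Finset.prod_le_prod (s := Finset.range (k + 1)) (f := fun _ : ℕ => δ / 2)
        (g := fun j : ℕ => f (x + (j : ℤ) * D)) (fun _ _ => by positivity)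
        (fun j hj => (Finset.mem_filter.1 (h j hj)).2)
      rwa [Finset.prod_const, Finset.card_range] at this
    · rw [SZ.ind_false h, mul_zero]
      exact Finset.prod_nonneg fun j _ => (hf _).1
  rw [inv_mul_eq_div, le_div_iff₀ (by positivity)]
  refine le_trans (le_of_eq ?_) ((mul_le_mul_of_nonneg_left h2 (by positivity)).trans h3)
  ring
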